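/- arXiv:math/0605588 — 4 statements merged into one kernel-verified Lean document; each statement's English description precedes it below -/
import Mathlib

section
/- Let p1, p2, p3, p4, p5, p6 be natural numbers with p1 + p6 ≥ max(p2 + p5, p3 + p4). Then (p1,...,p6) admits no decomposition if and only if at least one of the following holds: (i) p1 = 0 or p6 = 0; (ii) p1 + p6 ≤ max(p2 + p5, p3 + p4) + 1; (iii) 2·p1 + p6 < p2 + p3 + 3, or 2·p1 + p6 < p4 + p5 + 3, or 2·p6 + p1 < p2 + p4 + 3, or 2·p6 + p1 < p3 + p5 + 3; (iv) 2·p1 + p6 ≥ p2 + p3 + 3, 2·p1 + p6 ≥ p4 + p5 + 3, 2·p6 + p1 ≥ p2 + p4 + 3, 2·p6 + p1 ≥ p3 + p5 + 3, p1 + p6 = p2 + p5 + 2 = p3 + p4 + 2, and p1 + p3 + p5 is even. -/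
/-- `(p1,…,p6)` admits a decomposition: there are positive integers `i,j,l,m` with
`i+j = p1+1`, `l+m = p6+1`, `i+l ≥ p2+2`, `i+m ≥ p3+2`, `j+l ≥ p4+2`, `j+m ≥ p5+2`. -/
def AdmitsDecomposition (p1 p2 p3 p4 p5 p6 : ℕ) : Prop :=
  ∃ i j l m : ℕ, 0 < i ∧ 0 < j ∧ 0 < l ∧ 0 < m ∧
    i + j = p1 + 1 ∧ l + m = p6 + 1 ∧
    p2 + 2 ≤ i + l ∧ p3 + 2 ≤ i + m ∧ p4 + 2 ≤ j + l ∧ p5 + 2 ≤ j + m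

/-- Numerical form of the main theorem (Theorem 5.3): characterization of the
exponent vectors admitting no decomposition. -/
theorem tetrahedral_main (p1 p2 p3 p4 p5 p6 : ℕ)
    (h : max (p2 + p5) (p3 + p4) ≤ p1 + p6) :
    ¬ AdmitsDecomposition p1 p2 p3 p4 p5 p6 ↔
      ((p1 = 0 ∨ p6 = 0) ∨
       (p1 + p6 ≤ max (p2 + p5) (p3 + p4) + 1) ∨
       (2 * p1 + p6 < p2 + p3 + 3 ∨ 2 * p1 + p6 < p4 + p5 + 3 ∨
        2 * p6 + p1 < p2 + p4 + 3 ∨ 2 * p6 + p1 < p3 + p5 + 3) ∨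
       (p2 + p3 + 3 ≤ 2 * p1 + p6 ∧ p4 + p5 + 3 ≤ 2 * p1 + p6 ∧
        p2 + p4 + 3 ≤ 2 * p6 + p1 ∧ p3 + p5 + 3 ≤ 2 * p6 + p1 ∧
        p1 + p6 = p2 + p5 + 2 ∧ p1 + p6 = p3 + p4 + 2 ∧ Even (p1 + p3 + p5))) := by
  have hA : p2 + p5 ≤ p1 + p6 := le_trans (le_max_left _ _) h
  have hB : p3 + p4 ≤ p1 + p6 := le_trans (le_max_right _ _) h
  constructor
  · intro hn
    by_contra hc
    simp only [not_or] at hc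
    obtain ⟨⟨h1, h6⟩, h2, ⟨c1, c2, c3, c4⟩, h4⟩ := hc
    have hA2 : p2 + p5 + 2 ≤ p1 + p6 := by omega
    have hB2 : p3 + p4 + 2 ≤ p1 + p6 := by omega
    have hpar : p1 + p6 = p2 + p5 + 2 → p1 + p6 = p3 + p4 + 2 → (p1 + p3 + p5) % 2 = 1 := by
      intro e1 e2
      by_contra hne
      exact h4 ⟨by omega, by omega, by omega, by omega, e1, e2,
        Nat.even_iff.mpr (by omega)⟩
    clear h4 h2 h
    apply hn
    have hl : ∃ l : ℕ, 1 ≤ l ∧ p2 + 2 ≤ l + p1 ∧ p4 + 2 ≤ l + p1 ∧ p2 + p4 + 3 ≤ 2 * l + p1 ∧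
        l ≤ p6 ∧ l + p3 + 1 ≤ p6 + p1 ∧ l + p5 + 1 ≤ p1 + p6 ∧
        2 * l + p5 + p3 + 1 ≤ p1 + 2 * p6 := by
      have key : ∀ l : ℕ, (l = 1 ∨ l + p1 = p2 + 2 ∨ l + p1 = p4 + 2 ∨
          l = (p2 + p4 + 4 - p1) / 2) → 1 ≤ l → p2 + 2 ≤ l + p1 → p4 + 2 ≤ l + p1 →
          p2 + p4 + 3 ≤ 2 * l + p1 → l ≤ p6 ∧ l + p3 + 1 ≤ p6 + p1 ∧ l + p5 + 1 ≤ p1 + p6 ∧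
          2 * l + p5 + p3 + 1 ≤ p1 + 2 * p6 := by
        intro l hl a b c d
        rcases hl with e | e | e | e
        · refine ⟨by omega, by omega, by omega, by omega⟩
        · refine ⟨by omega, by omega, by omega, by omega⟩
        · refine ⟨by omega, by omega, by omega, by omega⟩
        · refine ⟨by omega, by omega, by omega, by omega⟩
      obtain ⟨l, e, a, b, c, d⟩ : ∃ l : ℕ, (l = 1 ∨ l + p1 = p2 + 2 ∨ l + p1 = p4 + 2 ∨
          l = (p2 + p4 + 4 - p1) / 2) ∧ 1 ≤ l ∧ p2 + 2 ≤ l + p1 ∧ p4 + 2 ≤ l + p1 ∧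
          p2 + p4 + 3 ≤ 2 * l + p1 :=
        ⟨max (max 1 (p2 + 2 - p1)) (max (p4 + 2 - p1) ((p2 + p4 + 4 - p1) / 2)),
          by omega, by omega, by omega, by omega, by omega⟩
      exact ⟨l, a, b, c, d, key l e a b c d⟩
    obtain ⟨l, a, b, c, d, a', b', c', d'⟩ := hl
    obtain ⟨i, x1, x2, x3, y1, y2, y3⟩ : ∃ i : ℕ, 1 ≤ i ∧ p2 + 2 ≤ i + l ∧
        p3 + 1 + l ≤ i + p6 ∧ i ≤ p1 ∧ i + l + p5 ≤ p1 + p6 ∧ i + p4 + 1 ≤ p1 + l :=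
      ⟨max 1 (max (p2 + 2 - l) (p3 + 1 + l - p6)),
        by omega, by omega, by omega, by omega, by omega, by omega⟩
    exact ⟨i, p1 + 1 - i, l, p6 + 1 - l, by omega, by omega, by omega, by omega, by omega,
      by omega, by omega, by omega, by omega, by omega⟩
  · rintro hc ⟨i, j, l, m, hi, hj, hl, hm, e1, e2, f2, f3, f4, f5⟩
    rcases hc with hc | hc | hc | ⟨-, -, -, -, u, v, w⟩
    · omega
    · omega
    · omega
    · rw [Nat.even_iff] at w
      omega
end

section
/- Let p1, p3, p4, p6 be natural numbers with p1 + p6 ≥ p3 + p4. Then the 6-tuple (p1, 0, p3, p4, 0, p6) admits no decomposition if and only if p1 = 0, or p6 = 0, or p1 + p6 ≤ p3 + p4 + 1. -/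
/-- Corollary 4.3 (Schwartau curves): with `p2 = p5 = 0` and `p1 + p6 ≥ p3 + p4`,
`(p1, 0, p3, p4, 0, p6)` admits no decomposition iff `p1 = 0`, `p6 = 0`, or
`p1 + p6 ≤ p3 + p4 + 1`. -/
theorem schwartau_characterization (p1 p3 p4 p6 : ℕ) (h : p3 + p4 ≤ p1 + p6) :
    ¬ AdmitsDecomposition p1 0 p3 p4 0 p6 ↔
      (p1 = 0 ∨ p6 = 0 ∨ p1 + p6 ≤ p3 + p4 + 1) := by
  constructor
  · intro hn
    by_contra hc
    apply hn
    refine ⟨min p1 (p3 + 1), p1 + 1 - min p1 (p3 + 1),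
      p6 + 1 - (p3 + 2 - min p1 (p3 + 1)), p3 + 2 - min p1 (p3 + 1), ?_⟩
    omega
  · rintro hc ⟨i, j, l, m, hd⟩
    omega
end

section
/- Let p1,...,p6 be natural numbers with p1 > 0, p6 > 0, p1 + p6 ≥ max(p2 + p5, p3 + p4) + 2, and p1 + p6 ≥ min(p2 + p5, p3 + p4) + 3. Suppose moreover that 2·p1 + p6 ≥ p2 + p3 + 3, 2·p1 + p6 ≥ p4 + p5 + 3, 2·p6 + p1 ≥ p2 + p4 + 3, and 2·p6 + p1 ≥ p3 + p5 + 3. Then (p1,...,p6) admits a decomposition. -/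
/-- Proposition 5.1: under the stated hypotheses a decomposition exists. -/
theorem decomposition_exists_of_large_gap (p1 p2 p3 p4 p5 p6 : ℕ)
    (h1 : 0 < p1) (h6 : 0 < p6)
    (hmax : max (p2 + p5) (p3 + p4) + 2 ≤ p1 + p6)
    (hmin : min (p2 + p5) (p3 + p4) + 3 ≤ p1 + p6)
    (i1 : p2 + p3 + 3 ≤ 2 * p1 + p6) (i2 : p4 + p5 + 3 ≤ 2 * p1 + p6)
    (i3 : p2 + p4 + 3 ≤ 2 * p6 + p1) (i4 : p3 + p5 + 3 ≤ 2 * p6 + p1) :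
    AdmitsDecomposition p1 p2 p3 p4 p5 p6 := by
  obtain ⟨i, hi⟩ : ∃ i : ℕ, i = max (max 1 (p3 + 2 - p6)) (max (p2 + 2 - p6) ((p2 + p3 + 4 - p6) / 2)) :=
    ⟨_, rfl⟩
  have a1 : 1 ≤ i := by omega
  have a2 : p3 + 2 ≤ i + p6 := by omega
  have a3 : p2 + 2 ≤ i + p6 := by omega
  have a4 : p2 + p3 + 3 ≤ 2 * i + p6 := by omega
  have b1 : i ≤ p1 := by omega
  have b2 : i + p5 + 1 ≤ p1 + p6 := by omega
  have b3 : i + p4 + 1 ≤ p1 + p6 := by omega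
  have b4 : 2 * i + p4 + p5 + 1 ≤ 2 * p1 + p6 := by omega
  clear hi
  obtain ⟨l, hl⟩ : ∃ l : ℕ, l = max 1 (max (p2 + 2 - i) (p4 + 1 + i - p1)) := ⟨_, rfl⟩
  refine ⟨i, p1 + 1 - i, l, p6 + 1 - l, ?_, ?_, ?_, ?_, ?_, ?_, ?_, ?_, ?_, ?_⟩ <;> omega
end

section
/- Let p1,...,p6 be natural numbers with p1 > 0, p6 > 0, p1 + p6 = p2 + p5 + 2 = p3 + p4 + 2, and suppose 2·p1 + p6 ≥ p2 + p3 + 3, 2·p1 + p6 ≥ p4 + p5 + 3, 2·p6 + p1 ≥ p2 + p4 + 3, and 2·p6 + p1 ≥ p3 + p5 + 3. Then (p1,...,p6) admits no decomposition if and only if p1 + p3 + p5 is even. -/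
/-- Proposition 5.2: in the boundary case `p1+p6 = p2+p5+2 = p3+p4+2` with all four
inequalities holding, there is no decomposition iff `p1 + p3 + p5` is even. -/
theorem no_decomposition_iff_even (p1 p2 p3 p4 p5 p6 : ℕ)
    (h1 : 0 < p1) (h6 : 0 < p6)
    (e1 : p1 + p6 = p2 + p5 + 2) (e2 : p1 + p6 = p3 + p4 + 2)
    (i1 : p2 + p3 + 3 ≤ 2 * p1 + p6) (i2 : p4 + p5 + 3 ≤ 2 * p1 + p6)
    (i3 : p2 + p4 + 3 ≤ 2 * p6 + p1) (i4 : p3 + p5 + 3 ≤ 2 * p6 + p1) :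
    ¬ AdmitsDecomposition p1 p2 p3 p4 p5 p6 ↔ Even (p1 + p3 + p5) := by
  constructor
  · intro h
    by_contra hodd
    rw [Nat.even_iff] at hodd
    apply h
    obtain ⟨m, hm⟩ : ∃ m, 2 * m + p1 = p3 + p5 + 3 :=
      ⟨(p3 + p5 + 3 - p1) / 2, by omega⟩
    exact ⟨p3 + 2 - m, p5 + 2 - m, p6 + 1 - m, m, by omega, by omega, by omega, by omega,
      by omega, by omega, by omega, by omega, by omega, by omega⟩
  · rintro h ⟨i, j, l, m, hi, hj, hl, hm, a, b, c, d, e, f⟩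
    rw [Nat.even_iff] at h
    omega
end
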